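/- arXiv:2305.06010 — 8 statements merged into one kernel-verified Lean document; each statement's English description precedes it below -/
import Mathlib

section
/- Let Y and Z be real symmetric positive definite n×n matrices with Y − Z positive semidefinite. Then ‖Y − Z‖₂ ≤ ‖Z‖₂ · (exp(δ(Y,Z)) − 1). -/
/-- The spectral (operator) norm of a real square matrix, induced by the Euclidean norm. -/
noncomputable def specNorm {n : ℕ} (M : Matrix (Fin n) (Fin n) ℝ) : ℝ :=
  ‖Matrix.toEuclideanCLM (𝕜 := ℝ) M‖

/-- The Riemannian distance `δ(Y,Z) = sqrt (Σᵢ (log λᵢ)²)` where `λ₁, …, λₙ` are the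
eigenvalues, with multiplicity, of `Y Z⁻¹` (equivalently, of `Z^{-1/2} Y Z^{-1/2}`),
realized as the roots of its characteristic polynomial. -/
noncomputable def riemDelta {n : ℕ} (Y Z : Matrix (Fin n) (Fin n) ℝ) : ℝ :=
  Real.sqrt ((((Y * Z⁻¹).charpoly.roots).map (fun r => Real.log r ^ 2)).sum)

open scoped MatrixOrder in
lemma aux_factor {n : ℕ} {A : Matrix (Fin n) (Fin n) ℝ} (hA : A.PosSemidef) :
    ∃ C : Matrix (Fin n) (Fin n) ℝ, A = star C * C :=
  CStarAlgebra.nonneg_iff_eq_star_mul_self.mp (Matrix.nonneg_iff_posSemidef.mpr hA)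

/-- Norm comparison for `0 ≤ A ≤ t Z`. -/
lemma aux_norm {n : ℕ} {A Z : Matrix (Fin n) (Fin n) ℝ} {t : ℝ} (ht : 0 ≤ t)
    (hA : A.PosSemidef) (h : (t • Z - A).PosSemidef) :
    specNorm A ≤ specNorm Z * t := by
  obtain ⟨C, rfl⟩ := aux_factor hA
  have hZ0 : 0 ≤ specNorm Z := norm_nonneg _
  have key : ‖Matrix.toEuclideanCLM (𝕜 := ℝ) C‖ ≤ Real.sqrt (specNorm Z * t) := by
    refine ContinuousLinearMap.opNorm_le_bound _ (Real.sqrt_nonneg _) fun x => ?_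
    refine (sq_le_sq₀ (by positivity) (by positivity)).mp ?_
    rw [mul_pow, Real.sq_sqrt (by positivity)]
    have h1 := h.dotProduct_mulVec_nonneg x.ofLp
    have h2 : inner ℝ x (Matrix.toEuclideanCLM (𝕜 := ℝ) Z x) ≤ specNorm Z * ‖x‖ ^ 2 := by
      refine (real_inner_le_norm _ _).trans ?_
      have := (Matrix.toEuclideanCLM (𝕜 := ℝ) Z).le_opNorm x
      have h3 := mul_le_mul_of_nonneg_left this (norm_nonneg x)
      unfold specNorm
      linarith [h3]
    have h4 : ‖Matrix.toEuclideanCLM (𝕜 := ℝ) C x‖ ^ 2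
        = inner ℝ x (Matrix.toEuclideanCLM (𝕜 := ℝ) (star C * C) x) := by
      rw [map_mul, map_star, ContinuousLinearMap.star_eq_adjoint, mul_apply_eq_comp,
        ContinuousLinearMap.adjoint_inner_right, real_inner_self_eq_norm_sq]
    rw [h4, Matrix.inner_toEuclideanCLM]
    rw [Matrix.inner_toEuclideanCLM] at h2
    simp only [star_trivial, Matrix.sub_mulVec, Matrix.smul_mulVec, dotProduct_sub,
      dotProduct_smul, smul_eq_mul] at h1
    have := mul_le_mul_of_nonneg_left h2 ht
    linarith
  have e : specNorm (star C * C) = ‖Matrix.toEuclideanCLM (𝕜 := ℝ) C‖ ^ 2 := by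
    unfold specNorm
    rw [map_mul, map_star, sq, ContinuousLinearMap.star_eq_adjoint]
    exact ContinuousLinearMap.norm_adjoint_comp_self _
  rw [e, ← Real.sq_sqrt (show 0 ≤ specNorm Z * t by positivity)]
  gcongr

lemma aux_eig {n : ℕ} {W : Matrix (Fin n) (Fin n) ℝ} (hW : W.IsHermitian) {c : ℝ}
    (h : ∀ i, hW.eigenvalues i ≤ c) : (c • (1 : Matrix (Fin n) (Fin n) ℝ) - W).PosSemidef := by
  have hd : (Matrix.diagonal (fun i => c - hW.eigenvalues i)).PosSemidef :=
    Matrix.posSemidef_diagonal_iff.mpr fun i => sub_nonneg.mpr (h i)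
  have hU := hd.mul_mul_conjTranspose_same (hW.eigenvectorUnitary : Matrix (Fin n) (Fin n) ℝ)
  convert hU using 1
  have e : Matrix.diagonal (fun i => c - hW.eigenvalues i)
      = c • (1 : Matrix (Fin n) (Fin n) ℝ) - Matrix.diagonal (RCLike.ofReal ∘ hW.eigenvalues) := by
    ext i j
    by_cases hij : i = j <;> simp [hij, Matrix.diagonal_apply, Matrix.one_apply]
  have hs := hW.spectral_theorem
  rw [Unitary.conjStarAlgAut_apply] at hs
  have hu : (hW.eigenvectorUnitary : Matrix (Fin n) (Fin n) ℝ)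
      * star (hW.eigenvectorUnitary : Matrix (Fin n) (Fin n) ℝ) = 1 :=
    Unitary.coe_mul_star_self _
  rw [e, ← Matrix.star_eq_conjTranspose, mul_sub, sub_mul, mul_smul_comm, smul_mul_assoc, mul_one,
    hu]
  exact congrArg _ hs

/-- For SPD `Y, Z` with `Y − Z` positive semidefinite,
`‖Y − Z‖₂ ≤ ‖Z‖₂ (exp(δ(Y,Z)) − 1)`. -/
theorem specNorm_sub_le_of_posSemidef_sub {n : ℕ} (Y Z : Matrix (Fin n) (Fin n) ℝ)
    (hY : Y.PosDef) (hZ : Z.PosDef) (hYZ : (Y - Z).PosSemidef) :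
    specNorm (Y - Z) ≤ specNorm Z * (Real.exp (riemDelta Y Z) - 1) := by
  have hδ : 0 ≤ riemDelta Y Z := Real.sqrt_nonneg _
  refine aux_norm (by linarith [Real.one_le_exp hδ]) hYZ ?_
  obtain ⟨B, hB⟩ := aux_factor hZ.posSemidef
  have hBu : IsUnit B := isUnit_of_mul_isUnit_right (hB ▸ hZ.isUnit)
  have hBd : IsUnit B.det := (Matrix.isUnit_iff_isUnit_det _).mp hBu
  have hBi : IsUnit B⁻¹ := Matrix.isUnit_nonsing_inv_iff.mpr hBu
  have hW : (star B⁻¹ * Y * B⁻¹).PosDef := (Matrix.IsUnit.posDef_star_left_conjugate_iff hBi).mpr hY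
  set W := star B⁻¹ * Y * B⁻¹ with hWdef
  have hs : star B * star B⁻¹ = 1 := by
    rw [← star_mul, Matrix.nonsing_inv_mul _ hBd, star_one]
  have hYW : star B * W * B = Y := by
    rw [hWdef]
    calc _ = (star B * star B⁻¹) * Y * (B⁻¹ * B) := by simp only [mul_assoc]
      _ = Y := by rw [hs, Matrix.nonsing_inv_mul _ hBd, one_mul, mul_one]
  have hZi : Z⁻¹ = B⁻¹ * star B⁻¹ := by
    apply Matrix.inv_eq_right_inv
    rw [hB]
    calc _ = star B * (B * B⁻¹) * star B⁻¹ := by simp only [mul_assoc]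
      _ = 1 := by rw [Matrix.mul_nonsing_inv _ hBd, mul_one, hs]
  have hch : (Y * Z⁻¹).charpoly = W.charpoly := by
    rw [hZi, ← mul_assoc, Matrix.charpoly_mul_comm, ← mul_assoc]
  have hle : ∀ i, hW.1.eigenvalues i ≤ Real.exp (riemDelta Y Z) := by
    intro i
    rw [← Real.log_le_iff_le_exp (hW.eigenvalues_pos i)]
    refine (le_abs_self _).trans (Real.abs_le_sqrt ?_)
    rw [hch, hW.1.roots_charpoly_eq_eigenvalues, Multiset.map_map]
    exact Finset.single_le_sum (f := fun i => Real.log (hW.1.eigenvalues i) ^ 2)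
      (fun _ _ => sq_nonneg _) (Finset.mem_univ i)
  have h1 := (aux_eig hW.1 hle).conjTranspose_mul_mul_same B
  rw [← Matrix.star_eq_conjTranspose, mul_sub, sub_mul, hYW, mul_smul_comm, smul_mul_assoc, mul_one,
    ← hB] at h1
  convert h1 using 1
  rw [sub_smul, one_smul]
  abel
end

section
/- Uniform bound on the Riccati operator under full-row-rank input matrix: let A ∈ ℝ^{n×n}, let B ∈ ℝ^{n×m} have full row rank (so that BBᵀ is invertible), let Q ∈ ℝ^{n×n} be symmetric positive semidefinite and R ∈ ℝ^{m×m} symmetric positive definite. Then for every symmetric positive semidefinite X ∈ ℝ^{n×n}, 𝓡(X) ⪯ Q + Aᵀ(BBᵀ)⁻¹ B R Bᵀ (BBᵀ)⁻¹ A. -/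
open Matrix

/-- The Riccati operator
`𝓡(P) = Q + Aᵀ (P − P B (R + Bᵀ P B)⁻¹ Bᵀ P) A`. -/
noncomputable def ricc {n m : ℕ} (A : Matrix (Fin n) (Fin n) ℝ) (B : Matrix (Fin n) (Fin m) ℝ)
    (Q : Matrix (Fin n) (Fin n) ℝ) (R : Matrix (Fin m) (Fin m) ℝ)
    (P : Matrix (Fin n) (Fin n) ℝ) : Matrix (Fin n) (Fin n) ℝ :=
  Q + Aᵀ * (P - P * B * (R + Bᵀ * P * B)⁻¹ * (Bᵀ * P)) * A

/-- uniform bound on the Riccati operator under full-row-rank `B`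
(encoded, as in the paper, by invertibility of `B Bᵀ`):
`𝓡(X) ⪯ Q + Aᵀ (BBᵀ)⁻¹ B R Bᵀ (BBᵀ)⁻¹ A` for every positive semidefinite `X`. -/
theorem riccati_uniform_upper_bound {n m : ℕ} (A : Matrix (Fin n) (Fin n) ℝ)
    (B : Matrix (Fin n) (Fin m) ℝ) (Q : Matrix (Fin n) (Fin n) ℝ)
    (R : Matrix (Fin m) (Fin m) ℝ)
    (hQ : Q.PosSemidef) (hR : R.PosDef) (hB : IsUnit (B * Bᵀ))
    (X : Matrix (Fin n) (Fin n) ℝ) (hX : X.PosSemidef) :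
    (Q + Aᵀ * (B * Bᵀ)⁻¹ * B * R * Bᵀ * (B * Bᵀ)⁻¹ * A - ricc A B Q R X).PosSemidef := by
  have hS : (R + Bᵀ * X * B).PosDef := by
    refine hR.add_posSemidef ?_
    simpa using hX.conjTranspose_mul_mul_same B
  have hXt : Xᵀ = X := by simpa using hX.isHermitian.eq
  have hSt : (R + Bᵀ * X * B)ᵀ = R + Bᵀ * X * B := by
    simpa [Matrix.IsHermitian] using hS.isHermitian.eq
  have hSu := (Matrix.isUnit_iff_isUnit_det _).1 hS.isUnit
  have hBu := (Matrix.isUnit_iff_isUnit_det _).1 hB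
  have hGt : ((B * Bᵀ)⁻¹)ᵀ = (B * Bᵀ)⁻¹ := by
    rw [Matrix.transpose_nonsing_inv]; simp
  have hL : B * (Bᵀ * (B * Bᵀ)⁻¹) = 1 := by
    rw [← Matrix.mul_assoc, Matrix.mul_nonsing_inv _ hBu]
  have hLt : ((B * Bᵀ)⁻¹ * B) * Bᵀ = 1 := by
    rw [Matrix.mul_assoc, Matrix.nonsing_inv_mul _ hBu]
  have key := hS.posSemidef.conjTranspose_mul_mul_same
    ((Bᵀ * (B * Bᵀ)⁻¹ - (R + Bᵀ * X * B)⁻¹ * (Bᵀ * X)) * A)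
  convert key using 1
  have hTt : ((R + Bᵀ * X * B)⁻¹)ᵀ = (R + Bᵀ * X * B)⁻¹ := by
    rw [Matrix.transpose_nonsing_inv, hSt]
  have h1 := Matrix.mul_nonsing_inv _ hSu
  have h2 := Matrix.nonsing_inv_mul _ hSu
  simp only [ricc, Matrix.conjTranspose_eq_transpose_of_trivial, Matrix.transpose_mul,
    Matrix.transpose_sub, hTt, hGt, hXt, Matrix.transpose_transpose]
  generalize (B * Bᵀ)⁻¹ = G at *
  have h3 : (G * B) * (R + Bᵀ * X * B) * (Bᵀ * G) = G * B * R * Bᵀ * G + X := by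
    calc _ = G * B * R * Bᵀ * G + (G * B * Bᵀ) * X * (B * (Bᵀ * G)) := by
          simp only [Matrix.mul_add, Matrix.add_mul, Matrix.mul_assoc]
      _ = _ := by rw [hL, hLt]; simp
  generalize hSd : R + Bᵀ * X * B = S at *
  generalize S⁻¹ = T at *
  have h4 : (G * B - X * B * T) * S * (Bᵀ * G - T * (Bᵀ * X))
      = G * B * R * Bᵀ * G - (X - X * B * T * (Bᵀ * X)) := by
    calc _ = (G * B) * S * (Bᵀ * G) - (G * B) * (S * T) * (Bᵀ * X)
          - X * B * (T * S) * (Bᵀ * G) + X * B * T * (S * T) * (Bᵀ * X) := by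
          simp only [Matrix.mul_sub, Matrix.sub_mul, Matrix.mul_assoc]; abel
      _ = G * B * R * Bᵀ * G + X - (G * B * Bᵀ) * X - X * (B * (Bᵀ * G))
          + X * B * T * (Bᵀ * X) := by
          rw [h1, h2, h3]; simp only [Matrix.mul_one, Matrix.mul_assoc]
      _ = _ := by rw [hL, hLt]; simp only [Matrix.mul_one, Matrix.one_mul]; abel
  calc _ = Aᵀ * (G * B * R * Bᵀ * G - (X - X * B * T * (Bᵀ * X))) * A := by
        simp only [Matrix.mul_sub, Matrix.sub_mul, Matrix.mul_assoc]; abel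
    _ = _ := by rw [← h4]; simp only [Matrix.mul_assoc]
end

section
/- Lyapunov decrease for the one-step receding-horizon policy: let t ∈ ℕ, and for s ∈ {t, t+1} let A_s ∈ ℝ^{n×n}, B_s ∈ ℝ^{n×m}, symmetric positive semidefinite Q_s ∈ ℝ^{n×n}, symmetric positive definite R_s ∈ ℝ^{m×m} be given, and let X̂_{t+1}, X̂_{t+2} ∈ ℝ^{n×n} be symmetric positive definite with 𝓡_{t+1}(X̂_{t+2}) ⪯ X̂_{t+1}. Let K_t := (R_t + B_tᵀ X̂_{t+1} B_t)⁻¹ B_tᵀ X̂_{t+1} A_t, and for any x_t ∈ ℝⁿ set u_t := −K_t x_t and x_{t+1} := A_t x_t + B_t u_t. Then x_{t+1}ᵀ 𝓡_{t+1}(X̂_{t+2}) x_{t+1} − x_tᵀ 𝓡_t(X̂_{t+1}) x_t ≤ −(x_tᵀ Q_t x_t + u_tᵀ R_t u_t). -/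
open Matrix

/-- Lyapunov decrease for the one-step receding-horizon policy.
Here `(A₀,B₀,Q₀,R₀)` is the problem data at time `t` and `(A₁,B₁,Q₁,R₁)` is the data at
time `t+1`; `X₁ = X̂_{t+1}` and `X₂ = X̂_{t+2}`. -/
theorem lyapunov_decrease_one_step {n m : ℕ}
    (A₀ A₁ : Matrix (Fin n) (Fin n) ℝ) (B₀ B₁ : Matrix (Fin n) (Fin m) ℝ)
    (Q₀ Q₁ : Matrix (Fin n) (Fin n) ℝ) (R₀ R₁ : Matrix (Fin m) (Fin m) ℝ)
    (hQ₀ : Q₀.PosSemidef) (hQ₁ : Q₁.PosSemidef) (hR₀ : R₀.PosDef) (hR₁ : R₁.PosDef)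
    (X₁ X₂ : Matrix (Fin n) (Fin n) ℝ) (hX₁ : X₁.PosDef) (hX₂ : X₂.PosDef)
    (hdec : (X₁ - ricc A₁ B₁ Q₁ R₁ X₂).PosSemidef)
    (K : Matrix (Fin m) (Fin n) ℝ)
    (hK : K = (R₀ + B₀ᵀ * X₁ * B₀)⁻¹ * (B₀ᵀ * X₁ * A₀))
    (x : Fin n → ℝ) (u : Fin m → ℝ) (hu : u = -(K *ᵥ x))
    (x' : Fin n → ℝ) (hx' : x' = A₀ *ᵥ x + B₀ *ᵥ u) :
    x' ⬝ᵥ (ricc A₁ B₁ Q₁ R₁ X₂) *ᵥ x' - x ⬝ᵥ (ricc A₀ B₀ Q₀ R₀ X₁) *ᵥ x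
      ≤ -(x ⬝ᵥ Q₀ *ᵥ x + u ⬝ᵥ R₀ *ᵥ u) := by
  have hS : (R₀ + B₀ᵀ * X₁ * B₀).PosDef := by
    refine hR₀.add_posSemidef ?_
    have := hX₁.posSemidef.conjTranspose_mul_mul_same B₀
    simpa [conjTranspose_eq_transpose_of_trivial] using this
  have hSK : (R₀ + B₀ᵀ * X₁ * B₀) * K = B₀ᵀ * X₁ * A₀ := by
    rw [hK, Matrix.mul_nonsing_inv_cancel_left _ _ ((Matrix.isUnit_iff_isUnit_det _).1 hS.isUnit)]
  have key : ricc A₀ B₀ Q₀ R₀ X₁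
      = Q₀ + (A₀ - B₀ * K)ᵀ * X₁ * (A₀ - B₀ * K) + Kᵀ * R₀ * K := by
    have h1 : ricc A₀ B₀ Q₀ R₀ X₁ = Q₀ + A₀ᵀ * X₁ * A₀ - A₀ᵀ * X₁ * B₀ * K := by
      rw [hK, ricc]
      simp only [Matrix.mul_sub, Matrix.sub_mul, Matrix.mul_assoc]
      abel
    have h2 : Kᵀ * ((R₀ + B₀ᵀ * X₁ * B₀) * K) = Kᵀ * (B₀ᵀ * X₁ * A₀) := by rw [hSK]
    rw [h1]
    simp only [Matrix.mul_sub, Matrix.sub_mul, Matrix.mul_assoc, Matrix.mul_add, Matrix.add_mul,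
      transpose_sub, transpose_mul] at h2 ⊢
    rw [← h2]
    abel
  have hx2 : x' = (A₀ - B₀ * K) *ᵥ x := by
    rw [hx', hu, Matrix.sub_mulVec, Matrix.mulVec_neg, Matrix.mulVec_mulVec, sub_eq_add_neg]
  have hq : ∀ {k : ℕ} (M : Matrix (Fin k) (Fin n) ℝ) (P : Matrix (Fin k) (Fin k) ℝ),
      x ⬝ᵥ (Mᵀ * P * M) *ᵥ x = (M *ᵥ x) ⬝ᵥ P *ᵥ (M *ᵥ x) := by
    intro k M P
    rw [← Matrix.mulVec_mulVec, ← Matrix.mulVec_mulVec, Matrix.dotProduct_mulVec,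
      Matrix.vecMul_transpose]
  have hd : 0 ≤ x' ⬝ᵥ (X₁ - ricc A₁ B₁ Q₁ R₁ X₂) *ᵥ x' := by
    simpa using hdec.dotProduct_mulVec_nonneg x'
  have hu2 : u ⬝ᵥ R₀ *ᵥ u = (K *ᵥ x) ⬝ᵥ R₀ *ᵥ (K *ᵥ x) := by
    rw [hu]; simp [Matrix.mulVec_neg]
  rw [Matrix.sub_mulVec, dotProduct_sub] at hd
  rw [key, Matrix.add_mulVec, Matrix.add_mulVec, dotProduct_add, dotProduct_add, hq, hq, ← hx2, hu2]
  linarith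
end

section
/- Exponential stability of the one-step receding-horizon closed loop: let (A_t)_{t∈ℕ} ⊂ ℝ^{n×n}, (B_t)_{t∈ℕ} ⊂ ℝ^{n×m}, symmetric positive definite (Q_t)_{t∈ℕ} ⊂ ℝ^{n×n}, symmetric positive definite (R_t)_{t∈ℕ} ⊂ ℝ^{m×m}, and let (X̂_{t+1})_{t∈ℕ} be symmetric positive definite matrices with 𝓡_{t+1}(X̂_{t+2}) ⪯ X̂_{t+1} for all t ∈ ℕ. Let K_t := (R_t + B_tᵀ X̂_{t+1} B_t)⁻¹ B_tᵀ X̂_{t+1} A_t, and let the closed-loop state satisfy x_{t+1} = A_t x_t + B_t u_t with u_t = −K_t x_t. Suppose ω̄, ω̲, λ̲ > 0 are constants such that, for all t ∈ ℕ, ‖𝓡_t(X̂_{t+1})‖₂ ≤ ω̄, λ_min(𝓡_t(X̂_{t+1})) ≥ ω̲, and λ_min(Q_t + K_tᵀ R_t K_t) ≥ λ̲, with λ̲ ≤ ω̄. Then for all t ∈ ℕ, |x_t|² ≤ (ω̄/ω̲) · (1 − λ̲/ω̄)^t · |x_0|². -/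
open Matrix

/-- The smallest eigenvalue of a (symmetric) real square matrix. -/
noncomputable def lamMin {n : ℕ} (M : Matrix (Fin n) (Fin n) ℝ) : ℝ :=
  sInf (spectrum ℝ M)

theorem lamMin_quad {n : ℕ} (M : Matrix (Fin n) (Fin n) ℝ) (hM : M.IsHermitian) (c : ℝ)
    (hc : c ≤ lamMin M) (v : Fin n → ℝ) : c * (v ⬝ᵥ v) ≤ v ⬝ᵥ (M *ᵥ v) := by
  have hps : (M - algebraMap ℝ (Matrix (Fin n) (Fin n) ℝ) c).PosSemidef := by
    rw [Matrix.posSemidef_iff_isHermitian_and_spectrum_nonneg]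
    refine ⟨?_, ?_⟩
    · apply hM.sub
      rw [Algebra.algebraMap_eq_smul_one]
      simp [Matrix.IsHermitian]
    · intro y hy
      rw [← spectrum.sub_singleton_eq] at hy
      obtain ⟨a, ha, b, hb, rfl⟩ := hy
      have hb' : b = c := hb
      have hfin : (spectrum ℝ M).Finite := Matrix.finite_real_spectrum
      have : lamMin M ≤ a := csInf_le hfin.bddBelow ha
      simp only [Set.mem_setOf_eq]
      linarith
  have h := hps.dotProduct_mulVec_nonneg v
  rw [Algebra.algebraMap_eq_smul_one, Matrix.sub_mulVec, Matrix.smul_mulVec, Matrix.one_mulVec,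
    star_trivial, dotProduct_sub, dotProduct_smul, smul_eq_mul] at h
  linarith

theorem specNorm_quad {n : ℕ} (M : Matrix (Fin n) (Fin n) ℝ) (c : ℝ)
    (hc : specNorm M ≤ c) (v : Fin n → ℝ) : v ⬝ᵥ (M *ᵥ v) ≤ c * (v ⬝ᵥ v) := by
  have h1 := real_inner_le_norm (WithLp.toLp 2 v) (Matrix.toEuclideanCLM (𝕜 := ℝ) M (WithLp.toLp 2 v))
  have h2 := (Matrix.toEuclideanCLM (𝕜 := ℝ) M).le_opNorm (WithLp.toLp 2 v)
  have h3 : ‖WithLp.toLp 2 v‖ * ‖WithLp.toLp 2 v‖ = v ⬝ᵥ v := by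
    rw [← real_inner_self_eq_norm_mul_norm, EuclideanSpace.inner_eq_star_dotProduct]
    simp
  have h4 : inner ℝ (WithLp.toLp 2 v) (Matrix.toEuclideanCLM (𝕜 := ℝ) M (WithLp.toLp 2 v))
      = v ⬝ᵥ (M *ᵥ v) := by
    rw [EuclideanSpace.inner_eq_star_dotProduct, dotProduct_comm]
    simp
  rw [h4] at h1
  have h5 := norm_nonneg (WithLp.toLp 2 v)
  have hc' : ‖Matrix.toEuclideanCLM (𝕜 := ℝ) M‖ ≤ c := hc
  calc _ ≤ _ := h1
    _ ≤ ‖WithLp.toLp 2 v‖ * (c * ‖WithLp.toLp 2 v‖) := by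
      refine mul_le_mul_of_nonneg_left (h2.trans ?_) h5
      exact mul_le_mul_of_nonneg_right hc' h5
    _ = _ := by rw [← h3]; ring

theorem ricc_eq {n m : ℕ} (A : Matrix (Fin n) (Fin n) ℝ) (B : Matrix (Fin n) (Fin m) ℝ)
    (Q : Matrix (Fin n) (Fin n) ℝ) (R : Matrix (Fin m) (Fin m) ℝ)
    (P : Matrix (Fin n) (Fin n) ℝ) (hR : R.PosDef) (hP : P.PosDef)
    (K : Matrix (Fin m) (Fin n) ℝ) (hK : K = (R + Bᵀ * P * B)⁻¹ * (Bᵀ * P * A)) :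
    ricc A B Q R P = (Q + Kᵀ * R * K) + (A - B * K)ᵀ * P * (A - B * K) := by
  have hS : (R + Bᵀ * P * B).PosDef := by
    apply hR.add_posSemidef
    have := hP.posSemidef.conjTranspose_mul_mul_same B
    simpa using this
  have hSK : (R + Bᵀ * P * B) * K = Bᵀ * P * A := by
    rw [hK, ← Matrix.mul_assoc, Matrix.mul_nonsing_inv _ ((Matrix.isUnit_iff_isUnit_det _).1 hS.isUnit),
      Matrix.one_mul]
  have h1 : ricc A B Q R P = Q + Aᵀ * P * A - Aᵀ * P * B * K := by
    rw [hK, ricc]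
    simp only [Matrix.mul_sub, Matrix.sub_mul, Matrix.mul_assoc]
    abel
  have h2 : Kᵀ * R * K + Kᵀ * Bᵀ * P * B * K = Kᵀ * Bᵀ * P * A := by
    have := congrArg (Kᵀ * ·) hSK
    simpa only [Matrix.mul_add, Matrix.add_mul, Matrix.mul_assoc] using this
  rw [h1]
  have h3 : (Q + Kᵀ * R * K) + (A - B * K)ᵀ * P * (A - B * K)
      = Q + Aᵀ * P * A - Aᵀ * P * B * K
        + ((Kᵀ * R * K + Kᵀ * Bᵀ * P * B * K) - Kᵀ * Bᵀ * P * A) := by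
    simp only [Matrix.transpose_sub, Matrix.transpose_mul, Matrix.mul_sub, Matrix.sub_mul,
      Matrix.mul_assoc]
    abel
  rw [h3, h2, sub_self, add_zero]

/-- exponential stability of the one-step receding-horizon closed loop:
`|x_t|² ≤ (ω̄/ω̲) (1 − λ̲/ω̄)^t |x_0|²`. -/
theorem one_step_rh_exponential_stability {n m : ℕ}
    (A : ℕ → Matrix (Fin n) (Fin n) ℝ) (B : ℕ → Matrix (Fin n) (Fin m) ℝ)
    (Q : ℕ → Matrix (Fin n) (Fin n) ℝ) (R : ℕ → Matrix (Fin m) (Fin m) ℝ)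
    (Xh : ℕ → Matrix (Fin n) (Fin n) ℝ)
    (hQ : ∀ t, (Q t).PosDef) (hR : ∀ t, (R t).PosDef)
    (hXpos : ∀ t, (Xh (t + 1)).PosDef)
    (hdec : ∀ t, (Xh (t + 1) - ricc (A (t + 1)) (B (t + 1)) (Q (t + 1)) (R (t + 1)) (Xh (t + 2))).PosSemidef)
    (K : ℕ → Matrix (Fin m) (Fin n) ℝ)
    (hK : ∀ t, K t = (R t + (B t)ᵀ * Xh (t + 1) * B t)⁻¹ * ((B t)ᵀ * Xh (t + 1) * A t))
    (x : ℕ → Fin n → ℝ) (u : ℕ → Fin m → ℝ)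
    (hu : ∀ t, u t = -(K t *ᵥ x t))
    (hx : ∀ t, x (t + 1) = A t *ᵥ x t + B t *ᵥ u t)
    (wbar wlow lamlow : ℝ) (hwbar : 0 < wbar) (hwlow : 0 < wlow) (hlamlow : 0 < lamlow)
    (hlw : lamlow ≤ wbar)
    (hub : ∀ t, specNorm (ricc (A t) (B t) (Q t) (R t) (Xh (t + 1))) ≤ wbar)
    (hlb : ∀ t, wlow ≤ lamMin (ricc (A t) (B t) (Q t) (R t) (Xh (t + 1))))
    (hgain : ∀ t, lamlow ≤ lamMin (Q t + (K t)ᵀ * R t * K t)) :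
    ∀ t, x t ⬝ᵥ x t ≤ (wbar / wlow) * (1 - lamlow / wbar) ^ t * (x 0 ⬝ᵥ x 0) := by
  have hGps : ∀ t, (Q t + (K t)ᵀ * R t * K t).PosSemidef := fun t => by
    have := (hR t).posSemidef.conjTranspose_mul_mul_same (K t)
    exact (hQ t).posSemidef.add (by simpa using this)
  have hId := fun t => ricc_eq (A t) (B t) (Q t) (R t) (Xh (t + 1)) (hR t) (hXpos t) (K t) (hK t)
  have hWps : ∀ t, (ricc (A t) (B t) (Q t) (R t) (Xh (t + 1))).PosSemidef := fun t => by
    rw [hId t]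
    have := (hXpos t).posSemidef.conjTranspose_mul_mul_same (A t - B t * K t)
    exact (hGps t).add (by simpa using this)
  have hstep : ∀ t, x (t + 1) = (A t - B t * K t) *ᵥ x t := fun t => by
    rw [hx, hu, Matrix.sub_mulVec, Matrix.mulVec_neg, Matrix.mulVec_mulVec, sub_eq_add_neg]
  set W : ℕ → Matrix (Fin n) (Fin n) ℝ :=
    fun t => ricc (A t) (B t) (Q t) (R t) (Xh (t + 1)) with hW
  have hlow : ∀ t, wlow * (x t ⬝ᵥ x t) ≤ x t ⬝ᵥ (W t *ᵥ x t) := fun t =>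
    lamMin_quad _ (hWps t).isHermitian _ (hlb t) _
  have hup : ∀ t, x t ⬝ᵥ (W t *ᵥ x t) ≤ wbar * (x t ⬝ᵥ x t) := fun t =>
    specNorm_quad _ _ (hub t) _
  have hg : ∀ t, lamlow * (x t ⬝ᵥ x t) ≤ x t ⬝ᵥ ((Q t + (K t)ᵀ * R t * K t) *ᵥ x t) := fun t =>
    lamMin_quad _ (hGps t).isHermitian _ (hgain t) _
  have hV : ∀ t, x (t + 1) ⬝ᵥ (W (t + 1) *ᵥ x (t + 1))
      ≤ (1 - lamlow / wbar) * (x t ⬝ᵥ (W t *ᵥ x t)) := fun t => by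
    have h1 : 0 ≤ x (t + 1) ⬝ᵥ ((Xh (t + 1) - W (t + 1)) *ᵥ x (t + 1)) := by
      have := (hdec t).dotProduct_mulVec_nonneg (x (t + 1))
      simpa only [star_trivial] using this
    rw [Matrix.sub_mulVec, dotProduct_sub] at h1
    have h2 : x t ⬝ᵥ (W t *ᵥ x t) = x t ⬝ᵥ ((Q t + (K t)ᵀ * R t * K t) *ᵥ x t)
        + x (t + 1) ⬝ᵥ (Xh (t + 1) *ᵥ x (t + 1)) := by
      have : W t = _ := hId t
      rw [this, Matrix.add_mulVec _ ((A t - B t * K t)ᵀ * _ * _), dotProduct_add, hstep t]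
      congr 1
      rw [← Matrix.mulVec_mulVec, ← Matrix.mulVec_mulVec, Matrix.dotProduct_mulVec,
        Matrix.vecMul_transpose]
    have h3 : lamlow / wbar * (x t ⬝ᵥ (W t *ᵥ x t)) ≤ lamlow * (x t ⬝ᵥ x t) := by
      calc _ ≤ lamlow / wbar * (wbar * (x t ⬝ᵥ x t)) :=
            mul_le_mul_of_nonneg_left (hup t) (by positivity)
        _ = _ := by field_simp
    linarith [hg t]
  have hr : 0 ≤ 1 - lamlow / wbar := by
    have := (div_le_one hwbar).2 hlw
    linarith
  have hVt : ∀ t, x t ⬝ᵥ (W t *ᵥ x t) ≤ (1 - lamlow / wbar) ^ t * (x 0 ⬝ᵥ (W 0 *ᵥ x 0)) := by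
    intro t
    induction t with
    | zero => simp
    | succ k ih =>
      refine (hV k).trans ?_
      rw [pow_succ', mul_assoc]
      exact mul_le_mul_of_nonneg_left ih hr
  intro t
  have h5 : wlow * (x t ⬝ᵥ x t) ≤ (1 - lamlow / wbar) ^ t * (wbar * (x 0 ⬝ᵥ x 0)) :=
    ((hlow t).trans (hVt t)).trans (mul_le_mul_of_nonneg_left (hup 0) (pow_nonneg hr t))
  have h6 : (wbar / wlow) * (1 - lamlow / wbar) ^ t * (x 0 ⬝ᵥ x 0)
      = ((1 - lamlow / wbar) ^ t * (wbar * (x 0 ⬝ᵥ x 0))) / wlow := by ring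
  rw [h6, le_div_iff₀ hwlow]
  linarith
end

section
/- Monotonicity of the Riccati operator: let A ∈ ℝ^{n×n}, B ∈ ℝ^{n×m}, let Q ∈ ℝ^{n×n} be symmetric positive semidefinite and R ∈ ℝ^{m×m} symmetric positive definite. If X, P ∈ ℝ^{n×n} are symmetric positive semidefinite with P ⪯ X, then 𝓡(P) ⪯ 𝓡(X). -/
open Matrix

/-- Completion of squares. -/
lemma ricc_complete_square {n m : ℕ} (B : Matrix (Fin n) (Fin m) ℝ)
    (R : Matrix (Fin m) (Fin m) ℝ) (hR : R.PosDef)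
    (P : Matrix (Fin n) (Fin n) ℝ) (hP : P.PosSemidef) (K : Matrix (Fin m) (Fin n) ℝ) :
    (R + Bᵀ * P * B).PosDef ∧
    P - P * B * (R + Bᵀ * P * B)⁻¹ * (Bᵀ * P) +
      (K - (R + Bᵀ * P * B)⁻¹ * (Bᵀ * P))ᵀ * (R + Bᵀ * P * B) *
        (K - (R + Bᵀ * P * B)⁻¹ * (Bᵀ * P)) =
      (1 - B * K)ᵀ * P * (1 - B * K) + Kᵀ * R * K := by
  have hS : (R + Bᵀ * P * B).PosDef := by
    have h := hP.conjTranspose_mul_mul_same B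
    rw [conjTranspose_eq_transpose_of_trivial] at h
    exact hR.add_posSemidef h
  refine ⟨hS, ?_⟩
  have hSt : (R + Bᵀ * P * B)ᵀ = R + Bᵀ * P * B := by
    simpa [IsHermitian, conjTranspose_eq_transpose_of_trivial] using hS.isHermitian
  have hPt : Pᵀ = P := by
    simpa [IsHermitian, conjTranspose_eq_transpose_of_trivial] using hP.isHermitian
  have hdet : IsUnit (R + Bᵀ * P * B).det := (isUnit_iff_isUnit_det _).1 hS.isUnit
  have hdef : R = (R + Bᵀ * P * B) - Bᵀ * P * B := by abel
  generalize hSdef : R + Bᵀ * P * B = S at *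
  have hL : S * (S⁻¹ * (Bᵀ * P)) = Bᵀ * P := mul_nonsing_inv_cancel_left _ _ hdet
  have hL' : (S⁻¹ * (Bᵀ * P))ᵀ * S = P * B := by
    have := congrArg transpose hL
    rw [transpose_mul, hSt] at this
    rw [this, transpose_mul, hPt, transpose_transpose]
  rw [hdef, Matrix.mul_assoc (P * B) S⁻¹]
  generalize S⁻¹ * (Bᵀ * P) = L at *
  have e : (K - L)ᵀ * S * (K - L) = Kᵀ * S * K - Kᵀ * (S * L) - Lᵀ * S * K + Lᵀ * S * L := by
    simp only [transpose_sub, Matrix.sub_mul, Matrix.mul_sub, Matrix.mul_assoc]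
    abel
  rw [e, hL, hL']
  simp only [transpose_sub, transpose_one, transpose_mul, Matrix.sub_mul, Matrix.mul_sub,
    Matrix.mul_assoc, Matrix.one_mul, Matrix.mul_one]
  abel

/-- monotonicity of the Riccati operator: if `P ⪯ X` then `𝓡(P) ⪯ 𝓡(X)`. -/
theorem riccati_monotone {n m : ℕ} (A : Matrix (Fin n) (Fin n) ℝ)
    (B : Matrix (Fin n) (Fin m) ℝ) (Q : Matrix (Fin n) (Fin n) ℝ)
    (R : Matrix (Fin m) (Fin m) ℝ)
    (hQ : Q.PosSemidef) (hR : R.PosDef)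
    (X P : Matrix (Fin n) (Fin n) ℝ) (hX : X.PosSemidef) (hP : P.PosSemidef)
    (hPX : (X - P).PosSemidef) :
    (ricc A B Q R X - ricc A B Q R P).PosSemidef := by
  obtain ⟨_, h1⟩ := ricc_complete_square B R hR X hX ((R + Bᵀ * X * B)⁻¹ * (Bᵀ * X))
  obtain ⟨hS, h2⟩ := ricc_complete_square B R hR P hP ((R + Bᵀ * X * B)⁻¹ * (Bᵀ * X))
  rw [sub_self, Matrix.mul_zero, add_zero] at h1
  have h2' := eq_sub_of_add_eq h2
  unfold ricc
  rw [h1, h2']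
  generalize (R + Bᵀ * X * B)⁻¹ * (Bᵀ * X) = K
  generalize (R + Bᵀ * P * B)⁻¹ * (Bᵀ * P) = L
  have a := hPX.conjTranspose_mul_mul_same (1 - B * K)
  have b := hS.posSemidef.conjTranspose_mul_mul_same (K - L)
  have c := (a.add b).conjTranspose_mul_mul_same A
  simp only [conjTranspose_eq_transpose_of_trivial] at c
  convert c using 1
  rw [add_sub_add_left_eq_sub, ← Matrix.sub_mul, ← Matrix.mul_sub, Matrix.mul_sub _ X P,
    Matrix.sub_mul]
  congr 2
  abel
end

section
/- Quadratic value-function Lipschitz bound via the Riemannian metric: let A ∈ ℝ^{n×n}, B ∈ ℝ^{n×m}, let Q ∈ ℝ^{n×n} be symmetric positive definite and R ∈ ℝ^{m×m} symmetric positive definite. Let X, P ∈ ℝ^{n×n} be symmetric positive definite with P ⪯ X, and suppose the contraction inequality δ(𝓡(X), 𝓡(P)) ≤ δ(X,P) holds. Then for every χ ∈ ℝⁿ, χᵀ𝓡(X)χ − χᵀ𝓡(P)χ ≤ ‖𝓡(P)‖₂ · |χ|² · (exp(δ(X,P)) − 1). -/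
open Matrix

lemma ricc_posDef {n m : ℕ} (A : Matrix (Fin n) (Fin n) ℝ)
    (B : Matrix (Fin n) (Fin m) ℝ) (Q : Matrix (Fin n) (Fin n) ℝ)
    (R : Matrix (Fin m) (Fin m) ℝ) (hQ : Q.PosDef) (hR : R.PosDef)
    (P : Matrix (Fin n) (Fin n) ℝ) (hP : P.PosDef) : (ricc A B Q R P).PosDef := by
  unfold ricc
  have hPs : Pᵀ = P := by simpa using hP.isHermitian.eq
  have hS : (R + Bᵀ * P * B).PosDef := by
    refine hR.add_posSemidef ?_
    simpa using hP.posSemidef.conjTranspose_mul_mul_same B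
  set S := R + Bᵀ * P * B with hSdef
  have hSs : Sᵀ = S := by simpa using hS.isHermitian.eq
  have hSd : IsUnit S.det := (Matrix.isUnit_iff_isUnit_det _).1 hS.isUnit
  obtain ⟨L, hL⟩ : ∃ L, L = S⁻¹ * (Bᵀ * P) := ⟨_, rfl⟩
  have hSL : S * L = Bᵀ * P := by rw [hL, Matrix.mul_nonsing_inv_cancel_left _ _ hSd]
  have key : P - P * B * S⁻¹ * (Bᵀ * P) = (1 - B * L)ᵀ * P * (1 - B * L) + Lᵀ * R * L := by
    have h1 : Lᵀ * (R * L) + Lᵀ * (Bᵀ * (P * (B * L))) = Lᵀ * (Bᵀ * P) := by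
      rw [← hSL, hSdef, Matrix.add_mul, Matrix.mul_add]
      simp only [Matrix.mul_assoc]
    have h2 : P * B * S⁻¹ * (Bᵀ * P) = P * (B * L) := by
      rw [hL]; simp only [Matrix.mul_assoc]
    rw [h2]
    simp only [Matrix.transpose_sub, Matrix.transpose_one, Matrix.transpose_mul, Matrix.sub_mul,
      Matrix.mul_sub, Matrix.one_mul, Matrix.mul_one, Matrix.mul_assoc]
    rw [eq_sub_of_add_eq h1]
    abel
  refine hQ.add_posSemidef ?_
  rw [key]
  have h := ((hP.posSemidef.conjTranspose_mul_mul_same (1 - B * L)).add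
    (hR.posSemidef.conjTranspose_mul_mul_same L)).conjTranspose_mul_mul_same A
  simpa only [Matrix.conjTranspose_eq_transpose_of_trivial] using h

open scoped MatrixOrder Matrix.Norms.L2Operator in
lemma riem_bound {n : ℕ} (Y Z : Matrix (Fin n) (Fin n) ℝ) (hY : Y.IsHermitian) (hZ : Z.PosDef)
    (χ : Fin n → ℝ) :
    χ ⬝ᵥ Y *ᵥ χ ≤ Real.exp (riemDelta Y Z) * (χ ⬝ᵥ Z *ᵥ χ) := by
  obtain ⟨C, hCu, hC⟩ : ∃ C : Matrix (Fin n) (Fin n) ℝ, IsUnit C ∧ Z = Cᴴ * C := by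
    obtain ⟨C, hC⟩ := CStarAlgebra.nonneg_iff_eq_star_mul_self.1
      (Matrix.nonneg_iff_posSemidef.2 hZ.posSemidef)
    refine ⟨C, ?_, hC⟩
    have hu := (Matrix.isUnit_iff_isUnit_det _).1 hZ.isUnit
    rw [hC, Matrix.det_mul] at hu
    exact (Matrix.isUnit_iff_isUnit_det _).2 (isUnit_of_mul_isUnit_right hu)
  have hCd : IsUnit C.det := (Matrix.isUnit_iff_isUnit_det _).1 hCu
  have hCd' : IsUnit Cᴴ.det := (Matrix.isUnit_iff_isUnit_det _).1 (by simpa using hCu.star)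
  obtain ⟨W, hW⟩ : ∃ W, W = (C⁻¹)ᴴ * Y * C⁻¹ := ⟨_, rfl⟩
  have hWh : W.IsHermitian := by
    rw [hW]; exact Matrix.isHermitian_conjTranspose_mul_mul _ hY
  have hYW : Y = Cᴴ * W * C := by
    rw [hW, Matrix.conjTranspose_nonsing_inv]
    simp only [Matrix.mul_assoc]
    rw [Matrix.nonsing_inv_mul _ hCd, Matrix.mul_one,
      Matrix.mul_nonsing_inv_cancel_left _ _ hCd']
  have hchar : (Y * Z⁻¹).charpoly = W.charpoly := by
    rw [hC, Matrix.mul_inv_rev, ← Matrix.mul_assoc, Matrix.charpoly_mul_comm, hW,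
      Matrix.conjTranspose_nonsing_inv, Matrix.mul_assoc]
  have hδ : riemDelta Y Z = Real.sqrt (∑ i, Real.log (hWh.eigenvalues i) ^ 2) := by
    unfold riemDelta
    rw [hchar, hWh.roots_charpoly_eq_eigenvalues, Multiset.map_map]
    rfl
  have hev : ∀ i, hWh.eigenvalues i ≤ Real.exp (riemDelta Y Z) := by
    intro i
    rcases le_or_gt (hWh.eigenvalues i) 0 with h | h
    · exact h.trans (Real.exp_pos _).le
    · rw [← Real.log_le_iff_le_exp h, hδ]
      apply Real.le_sqrt_of_sq_le
      exact Finset.single_le_sum (f := fun i => Real.log (hWh.eigenvalues i) ^ 2)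
        (fun _ _ => sq_nonneg _) (Finset.mem_univ i)
  have hpsd : (algebraMap ℝ (Matrix (Fin n) (Fin n) ℝ) (Real.exp (riemDelta Y Z)) - W).PosSemidef := by
    rw [Matrix.posSemidef_iff_isHermitian_and_spectrum_nonneg]
    refine ⟨?_, ?_⟩
    · refine Matrix.IsHermitian.sub ?_ hWh
      rw [Algebra.algebraMap_eq_smul_one]
      simp [Matrix.IsHermitian]
    · rw [← spectrum.singleton_sub_eq, hWh.spectrum_real_eq_range_eigenvalues]
      rintro _ ⟨a, ha, b, ⟨i, rfl⟩, rfl⟩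
      have := hev i
      simp only [Set.mem_singleton_iff] at ha
      simp [ha, this]
  have h := (hpsd.conjTranspose_mul_mul_same C).dotProduct_mulVec_nonneg χ
  have e : Cᴴ * (algebraMap ℝ (Matrix (Fin n) (Fin n) ℝ) (Real.exp (riemDelta Y Z)) - W) * C
      = Real.exp (riemDelta Y Z) • Z - Y := by
    rw [Matrix.mul_sub, Matrix.sub_mul, ← hYW, Algebra.algebraMap_eq_smul_one, hC]
    simp
  rw [e, Matrix.sub_mulVec, Matrix.smul_mulVec, dotProduct_sub, dotProduct_smul] at h
  simp only [star_trivial, smul_eq_mul] at h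
  linarith

lemma specNorm_bound {n : ℕ} (Z : Matrix (Fin n) (Fin n) ℝ) (χ : Fin n → ℝ) :
    χ ⬝ᵥ Z *ᵥ χ ≤ specNorm Z * (χ ⬝ᵥ χ) := by
  have h1 : χ ⬝ᵥ Z *ᵥ χ = inner ℝ (WithLp.toLp 2 χ)
      (Matrix.toEuclideanCLM (𝕜 := ℝ) Z (WithLp.toLp 2 χ)) := by
    rw [Matrix.toEuclideanCLM_toLp, EuclideanSpace.inner_toLp_toLp, dotProduct_comm]; simp
  have h2 : χ ⬝ᵥ χ = ‖WithLp.toLp 2 χ‖ * ‖WithLp.toLp 2 χ‖ := by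
    rw [← real_inner_self_eq_norm_mul_norm, EuclideanSpace.inner_toLp_toLp]; simp
  rw [h1, h2, specNorm]
  refine (real_inner_le_norm _ _).trans ?_
  have := mul_le_mul_of_nonneg_left
    ((Matrix.toEuclideanCLM (𝕜 := ℝ) Z).le_opNorm (WithLp.toLp 2 χ))
    (norm_nonneg (WithLp.toLp 2 χ))
  linarith

/-- quadratic value-function Lipschitz bound via the Riemannian metric:
if `P ⪯ X` and `δ(𝓡(X),𝓡(P)) ≤ δ(X,P)` then
`χᵀ𝓡(X)χ − χᵀ𝓡(P)χ ≤ ‖𝓡(P)‖₂ |χ|² (exp(δ(X,P)) − 1)`. -/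
theorem value_function_lipschitz {n m : ℕ} (A : Matrix (Fin n) (Fin n) ℝ)
    (B : Matrix (Fin n) (Fin m) ℝ) (Q : Matrix (Fin n) (Fin n) ℝ)
    (R : Matrix (Fin m) (Fin m) ℝ) (hQ : Q.PosDef) (hR : R.PosDef)
    (X P : Matrix (Fin n) (Fin n) ℝ) (hX : X.PosDef) (hP : P.PosDef)
    (hPX : (X - P).PosSemidef)
    (hcontr : riemDelta (ricc A B Q R X) (ricc A B Q R P) ≤ riemDelta X P)
    (χ : Fin n → ℝ) :
    χ ⬝ᵥ (ricc A B Q R X) *ᵥ χ - χ ⬝ᵥ (ricc A B Q R P) *ᵥ χ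
      ≤ specNorm (ricc A B Q R P) * (χ ⬝ᵥ χ) * (Real.exp (riemDelta X P) - 1) := by
  have hYp := ricc_posDef A B Q R hQ hR X hX
  have hZp := ricc_posDef A B Q R hQ hR P hP
  have h1 := riem_bound _ _ hYp.isHermitian hZp χ
  have h2 := specNorm_bound (ricc A B Q R P) χ
  have h3 : 0 ≤ χ ⬝ᵥ (ricc A B Q R P) *ᵥ χ := by
    simpa using hZp.posSemidef.dotProduct_mulVec_nonneg χ
  have h4 := Real.exp_le_exp.2 hcontr
  have h5 : 1 ≤ Real.exp (riemDelta X P) := Real.one_le_exp (Real.sqrt_nonneg _)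
  have h6 := mul_le_mul_of_nonneg_right h4 h3
  have h7 := mul_le_mul_of_nonneg_right h2 (sub_nonneg.2 h5)
  linarith
end

section
/- Riemannian distance bound from an ordering: let X, P ∈ ℝ^{n×n} be symmetric positive definite with P ⪯ X. Then δ(X,P) ≤ √n · log(‖X‖₂ / λ_min(P)). -/
open Matrix

lemma aux_P {n : ℕ} (P : Matrix (Fin n) (Fin n) ℝ) (hP : P.PosDef) (w : Fin n → ℝ) :
    lamMin P * (w ⬝ᵥ w) ≤ w ⬝ᵥ (P *ᵥ w) := by
  have hH : (P - algebraMap ℝ _ (lamMin P)).IsHermitian := by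
    apply hP.isHermitian.sub
    simp [IsHermitian, Algebra.algebraMap_eq_smul_one]
  have h : (P - algebraMap ℝ _ (lamMin P)).PosSemidef := by
    rw [posSemidef_iff_isHermitian_and_spectrum_nonneg]
    refine ⟨hH, ?_⟩
    intro x hx
    rw [← spectrum.sub_singleton_eq] at hx
    obtain ⟨y, hy, z, hz, rfl⟩ := hx
    rw [Set.mem_singleton_iff] at hz
    subst hz
    have : lamMin P ≤ y := csInf_le (Matrix.finite_real_spectrum).bddBelow hy
    simpa using this
  have := h.dotProduct_mulVec_nonneg w
  simp [sub_mulVec, Algebra.algebraMap_eq_smul_one, smul_mulVec, dotProduct_sub] at this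
  linarith

lemma aux_pos {n : ℕ} (hn : 0 < n) (P : Matrix (Fin n) (Fin n) ℝ) (hP : P.PosDef) :
    0 < lamMin P := by
  have hne : (spectrum ℝ P).Nonempty :=
    ⟨_, hP.isHermitian.eigenvalues_mem_spectrum_real ⟨0, hn⟩⟩
  have := hne.csInf_mem Matrix.finite_real_spectrum
  rw [hP.isHermitian.spectrum_real_eq_range_eigenvalues] at this
  obtain ⟨i, hi⟩ := this
  unfold lamMin
  rw [hP.isHermitian.spectrum_real_eq_range_eigenvalues, ← hi]
  exact hP.eigenvalues_pos i

lemma aux_X {n : ℕ} (X : Matrix (Fin n) (Fin n) ℝ) (w : Fin n → ℝ) :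
    w ⬝ᵥ (X *ᵥ w) ≤ specNorm X * (w ⬝ᵥ w) := by
  let u : EuclideanSpace ℝ (Fin n) := WithLp.toLp 2 w
  have h1 : inner ℝ u (Matrix.toEuclideanCLM (𝕜 := ℝ) X u) = w ⬝ᵥ (X *ᵥ w) := by
    simp [u, EuclideanSpace.inner_eq_star_dotProduct, dotProduct_comm]
  have h2 : ‖u‖ * ‖u‖ = w ⬝ᵥ w := by
    rw [← real_inner_self_eq_norm_mul_norm, EuclideanSpace.inner_eq_star_dotProduct]
    simp [u]
  rw [← h1, ← h2]
  have h3 := real_inner_le_norm u (Matrix.toEuclideanCLM (𝕜 := ℝ) X u)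
  have h4 := (Matrix.toEuclideanCLM (𝕜 := ℝ) X).le_opNorm u
  unfold specNorm
  nlinarith [norm_nonneg u]

/-- Riemannian distance bound from an ordering:
if `P ⪯ X` (both SPD) then `δ(X,P) ≤ √n log(‖X‖₂ / λ_min(P))`. -/
theorem riemDelta_le_of_order {n : ℕ} (X P : Matrix (Fin n) (Fin n) ℝ)
    (hX : X.PosDef) (hP : P.PosDef) (hPX : (X - P).PosSemidef) :
    riemDelta X P ≤ Real.sqrt n * Real.log (specNorm X / lamMin P) := by
  rcases Nat.eq_zero_or_pos n with rfl | hn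
  · simp [riemDelta]
  have hl := aux_pos hn P hP
  have hle (w : Fin n → ℝ) : w ⬝ᵥ (P *ᵥ w) ≤ w ⬝ᵥ (X *ᵥ w) := by
    have := hPX.dotProduct_mulVec_nonneg w
    simp [sub_mulVec, dotProduct_sub] at this
    exact this
  have hww (w : Fin n → ℝ) (hw : w ≠ 0) : 0 < w ⬝ᵥ w := by
    have := Matrix.dotProduct_star_self_pos_iff.2 hw
    simpa using this
  have hL1 : 1 ≤ specNorm X / lamMin P := by
    rw [one_le_div hl]
    have hw : (1 : Fin n → ℝ) ≠ 0 := fun h => by simpa using congrFun h ⟨0, hn⟩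
    have := (aux_P P hP 1).trans ((hle 1).trans (aux_X X 1))
    exact le_of_mul_le_mul_right this (hww 1 hw)
  have hL := Real.log_nonneg hL1
  have hroot : ∀ r ∈ (X * P⁻¹).charpoly.roots,
      Real.log r ^ 2 ≤ Real.log (specNorm X / lamMin P) ^ 2 := by
    intro r hr
    have hr' := Polynomial.isRoot_of_mem_roots hr
    rw [Polynomial.IsRoot, Matrix.eval_charpoly, ← Matrix.exists_mulVec_eq_zero_iff] at hr'
    obtain ⟨v, hv, hv0⟩ := hr'
    have hdet : IsUnit P.det := hP.det_pos.ne'.isUnit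
    set w := P⁻¹ *ᵥ v with hwd
    have hPw : P *ᵥ w = v := by simp [hwd, mulVec_mulVec, Matrix.mul_nonsing_inv P hdet]
    have hw : w ≠ 0 := by
      intro h
      rw [h, mulVec_zero] at hPw
      exact hv hPw.symm
    have hXw : X *ᵥ w = r • (P *ᵥ w) := by
      rw [hPw]
      rw [sub_mulVec, sub_eq_zero, ← mulVec_mulVec, ← hwd] at hv0
      rw [← hv0]
      ext i
      simp [Matrix.scalar_apply, mulVec_diagonal]
    have e : w ⬝ᵥ (X *ᵥ w) = r * (w ⬝ᵥ (P *ᵥ w)) := by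
      rw [hXw, dotProduct_smul, smul_eq_mul]
    have hPp := hP.dotProduct_mulVec_pos hw
    simp only [star_trivial] at hPp
    have h1 := hle w
    have h2 := aux_X X w
    have h3 := aux_P P hP w
    have h4 := hww w hw
    have hr1 : 1 ≤ r := by
      rw [e] at h1
      nlinarith
    have hr2 : r ≤ specNorm X / lamMin P := by
      rw [le_div_iff₀ hl]
      refine le_of_mul_le_mul_right ?_ h4
      nlinarith
    have := Real.log_nonneg hr1
    have := Real.log_le_log (by linarith) hr2
    gcongr
  unfold riemDelta
  rw [← Real.sqrt_sq hL, ← Real.sqrt_mul (Nat.cast_nonneg n)]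
  apply Real.sqrt_le_sqrt
  have hs := Multiset.sum_le_card_nsmul
    ((X * P⁻¹).charpoly.roots.map (fun r => Real.log r ^ 2))
    (Real.log (specNorm X / lamMin P) ^ 2) (by
      intro x hx
      obtain ⟨r, hr, rfl⟩ := Multiset.mem_map.1 hx
      exact hroot r hr)
  have hc := Polynomial.card_roots' (X * P⁻¹).charpoly
  rw [Matrix.charpoly_natDegree_eq_dim, Fintype.card_fin] at hc
  rw [Multiset.card_map, nsmul_eq_mul] at hs
  refine hs.trans ?_
  gcongr
end

section
/- Properties of the composed terminal penalties: fix T ≥ 1 and let, for each s ∈ ℕ, A_s ∈ ℝ^{n×n}, B_s ∈ ℝ^{n×m}, symmetric positive definite Q_s ∈ ℝ^{n×n} and symmetric positive definite R_s ∈ ℝ^{m×m} be given. Let (X_s)_{s∈ℕ} be symmetric positive definite matrices satisfying 𝓡_s(X_{s+1}) ⪯ X_s for all s, and let (P_s)_{s∈ℕ} be symmetric positive definite matrices satisfying P_s = 𝓡_s(P_{s+1}) and P_s ⪯ X_s for all s. Define X̂_s := 𝓡_s ∘ 𝓡_{s+1} ∘ ⋯ ∘ 𝓡_{s+T−2}(X_{s+T−1})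 for s ∈ ℕ (with X̂_s := X_s when T = 1). Then for all s ∈ ℕ, 𝓡_s(X̂_{s+1}) ⪯ X̂_s and P_s ⪯ X̂_s. -/
open Matrix

/-- `riccIter A B Q R s k X = 𝓡_s ∘ 𝓡_{s+1} ∘ ⋯ ∘ 𝓡_{s+k−1} (X)`. -/
noncomputable def riccIter {n m : ℕ} (A : ℕ → Matrix (Fin n) (Fin n) ℝ)
    (B : ℕ → Matrix (Fin n) (Fin m) ℝ) (Q : ℕ → Matrix (Fin n) (Fin n) ℝ)
    (R : ℕ → Matrix (Fin m) (Fin m) ℝ) :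
    ℕ → ℕ → Matrix (Fin n) (Fin n) ℝ → Matrix (Fin n) (Fin n) ℝ
  | _, 0, X => X
  | s, k + 1, X => ricc (A s) (B s) (Q s) (R s) (riccIter A B Q R (s + 1) k X)

theorem ricc_core {n m : ℕ} {B : Matrix (Fin n) (Fin m) ℝ} {R : Matrix (Fin m) (Fin m) ℝ}
    {P : Matrix (Fin n) (Fin n) ℝ} (hR : R.PosDef) (hP : P.PosSemidef) :
    (R + Bᵀ * P * B).PosDef := by
  have h := hP.conjTranspose_mul_mul_same B
  rw [conjTranspose_eq_transpose_of_trivial] at h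
  exact hR.add_posSemidef h

theorem ricc_square {n m : ℕ} {B : Matrix (Fin n) (Fin m) ℝ} {R : Matrix (Fin m) (Fin m) ℝ}
    {P : Matrix (Fin n) (Fin n) ℝ} (hR : R.PosDef) (hP : P.PosSemidef)
    (K : Matrix (Fin m) (Fin n) ℝ) :
    (1 - B * K)ᵀ * P * (1 - B * K) + Kᵀ * R * K =
      (P - P * B * (R + Bᵀ * P * B)⁻¹ * (Bᵀ * P)) +
      (K - (R + Bᵀ * P * B)⁻¹ * (Bᵀ * P))ᵀ * (R + Bᵀ * P * B) *
        (K - (R + Bᵀ * P * B)⁻¹ * (Bᵀ * P)) := by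
  have hS := ricc_core (B := B) hR hP
  have hSu : IsUnit (R + Bᵀ * P * B).det := (Matrix.isUnit_iff_isUnit_det _).1 hS.isUnit
  have hSt : (R + Bᵀ * P * B)ᵀ = R + Bᵀ * P * B := by
    have := hS.isHermitian.eq
    rwa [conjTranspose_eq_transpose_of_trivial] at this
  have hPt : Pᵀ = P := by
    have := hP.isHermitian.eq
    rwa [conjTranspose_eq_transpose_of_trivial] at this
  obtain ⟨W, hW⟩ : ∃ W, W = (R + Bᵀ * P * B)⁻¹ * (Bᵀ * P) := ⟨_, rfl⟩
  have h1 : (R + Bᵀ * P * B) * W = Bᵀ * P := by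
    rw [hW, Matrix.mul_nonsing_inv_cancel_left _ _ hSu]
  have h2 : Wᵀ * (R + Bᵀ * P * B) = P * B := by
    have := congrArg Matrix.transpose h1
    rwa [transpose_mul, hSt, transpose_mul, transpose_transpose, hPt] at this
  have h3 : P * B * (R + Bᵀ * P * B)⁻¹ * (Bᵀ * P) = P * B * W := by
    rw [hW, Matrix.mul_assoc (P * B)]
  rw [h3, ← hW]
  have h4 : (K - W)ᵀ * (R + Bᵀ * P * B) * (K - W) =
      Kᵀ * (R + Bᵀ * P * B) * K - Kᵀ * (Bᵀ * P) - P * B * K + P * B * W := by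
    rw [transpose_sub, Matrix.sub_mul, h2, Matrix.sub_mul, Matrix.mul_sub, Matrix.mul_sub,
      Matrix.mul_assoc Kᵀ _ W, h1]
    abel
  rw [h4]
  simp only [transpose_sub, transpose_one, transpose_mul, Matrix.sub_mul, Matrix.mul_sub,
    Matrix.mul_add, Matrix.add_mul, Matrix.one_mul, Matrix.mul_one, Matrix.mul_assoc]
  abel

theorem psd_conj {k l : ℕ} {M : Matrix (Fin k) (Fin k) ℝ} (h : M.PosSemidef)
    (C : Matrix (Fin k) (Fin l) ℝ) : (Cᵀ * M * C).PosSemidef := by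
  have := h.conjTranspose_mul_mul_same C
  rwa [conjTranspose_eq_transpose_of_trivial] at this

theorem ricc_psd {n m : ℕ} {A : Matrix (Fin n) (Fin n) ℝ} {B : Matrix (Fin n) (Fin m) ℝ}
    {Q : Matrix (Fin n) (Fin n) ℝ} {R : Matrix (Fin m) (Fin m) ℝ}
    {P : Matrix (Fin n) (Fin n) ℝ} (hQ : Q.PosSemidef) (hR : R.PosDef) (hP : P.PosSemidef) :
    (ricc A B Q R P).PosSemidef := by
  have h := ricc_square (B := B) hR hP ((R + Bᵀ * P * B)⁻¹ * (Bᵀ * P))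
  rw [sub_self, Matrix.mul_zero, add_zero] at h
  unfold ricc
  rw [← h]
  exact hQ.add (psd_conj ((psd_conj hP _).add (psd_conj hR.posSemidef _)) A)

theorem ricc_mono {n m : ℕ} {A : Matrix (Fin n) (Fin n) ℝ} {B : Matrix (Fin n) (Fin m) ℝ}
    {Q : Matrix (Fin n) (Fin n) ℝ} {R : Matrix (Fin m) (Fin m) ℝ}
    {M N : Matrix (Fin n) (Fin n) ℝ} (hR : R.PosDef) (hM : M.PosSemidef) (hN : N.PosSemidef)
    (hMN : (N - M).PosSemidef) :
    (ricc A B Q R N - ricc A B Q R M).PosSemidef := by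
  obtain ⟨K, hK⟩ : ∃ K, K = (R + Bᵀ * N * B)⁻¹ * (Bᵀ * N) := ⟨_, rfl⟩
  have h := ricc_square (B := B) hR hN K
  rw [← hK, sub_self, Matrix.mul_zero, add_zero] at h
  have h' := eq_sub_of_add_eq (ricc_square (B := B) hR hM K).symm
  have e : (N - N * B * (R + Bᵀ * N * B)⁻¹ * (Bᵀ * N)) -
      (M - M * B * (R + Bᵀ * M * B)⁻¹ * (Bᵀ * M)) =
      (1 - B * K)ᵀ * (N - M) * (1 - B * K) +
      (K - (R + Bᵀ * M * B)⁻¹ * (Bᵀ * M))ᵀ * (R + Bᵀ * M * B) *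
        (K - (R + Bᵀ * M * B)⁻¹ * (Bᵀ * M)) := by
    rw [h', ← h, Matrix.mul_sub _ N M, Matrix.sub_mul _ _ (1 - B * K)]
    abel
  have e2 : ricc A B Q R N - ricc A B Q R M =
      Aᵀ * ((N - N * B * (R + Bᵀ * N * B)⁻¹ * (Bᵀ * N)) -
      (M - M * B * (R + Bᵀ * M * B)⁻¹ * (Bᵀ * M))) * A := by
    unfold ricc
    rw [add_sub_add_left_eq_sub, ← Matrix.sub_mul, ← Matrix.mul_sub]
  rw [e2, e]
  exact psd_conj ((psd_conj hMN _).add (psd_conj (ricc_core hR hM).posSemidef _)) A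

section iter
variable {n m : ℕ} {A : ℕ → Matrix (Fin n) (Fin n) ℝ} {B : ℕ → Matrix (Fin n) (Fin m) ℝ}
    {Q : ℕ → Matrix (Fin n) (Fin n) ℝ} {R : ℕ → Matrix (Fin m) (Fin m) ℝ}

theorem riccIter_psd (hQ : ∀ s, (Q s).PosDef) (hR : ∀ s, (R s).PosDef)
    {M : Matrix (Fin n) (Fin n) ℝ} (hM : M.PosSemidef) (k : ℕ) :
    ∀ s, (riccIter A B Q R s k M).PosSemidef := by
  induction k with
  | zero => intro s; exact hM
  | succ k ih => intro s; exact ricc_psd (hQ s).posSemidef (hR s) (ih (s + 1))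

theorem riccIter_mono (hQ : ∀ s, (Q s).PosDef) (hR : ∀ s, (R s).PosDef)
    {M N : Matrix (Fin n) (Fin n) ℝ} (hM : M.PosSemidef) (hN : N.PosSemidef)
    (hMN : (N - M).PosSemidef) (k : ℕ) :
    ∀ s, (riccIter A B Q R s k N - riccIter A B Q R s k M).PosSemidef := by
  induction k with
  | zero => intro s; exact hMN
  | succ k ih =>
    intro s
    exact ricc_mono (hR s) (riccIter_psd hQ hR hM k _) (riccIter_psd hQ hR hN k _) (ih (s + 1))

theorem riccIter_last (M : Matrix (Fin n) (Fin n) ℝ) (k : ℕ) :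
    ∀ s, ricc (A s) (B s) (Q s) (R s) (riccIter A B Q R (s + 1) k M) =
      riccIter A B Q R s k
        (ricc (A (s + k)) (B (s + k)) (Q (s + k)) (R (s + k)) M) := by
  induction k with
  | zero => intro s; rfl
  | succ k ih =>
    intro s
    have := ih (s + 1)
    rw [show s + 1 + k = s + (k + 1) by omega] at this
    simp only [riccIter]
    rw [this]

theorem riccIter_fixed {P : ℕ → Matrix (Fin n) (Fin n) ℝ}
    (hP : ∀ s, P s = ricc (A s) (B s) (Q s) (R s) (P (s + 1))) (k : ℕ) :
    ∀ s, riccIter A B Q R s k (P (s + k)) = P s := by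
  induction k with
  | zero => intro s; rfl
  | succ k ih =>
    intro s
    have := ih (s + 1)
    rw [show s + 1 + k = s + (k + 1) by omega] at this
    simp only [riccIter]
    rw [this, ← hP]
end iter

/-- properties of the composed terminal penalties
`X̂_s = 𝓡_s ∘ ⋯ ∘ 𝓡_{s+T−2}(X_{s+T−1})` (with `X̂_s = X_s` for `T = 1`):
for all `s`, `𝓡_s(X̂_{s+1}) ⪯ X̂_s` and `P_s ⪯ X̂_s`. -/
theorem composed_terminal_penalty_props {n m : ℕ} (T : ℕ) (hT : 1 ≤ T)
    (A : ℕ → Matrix (Fin n) (Fin n) ℝ) (B : ℕ → Matrix (Fin n) (Fin m) ℝ)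
    (Q : ℕ → Matrix (Fin n) (Fin n) ℝ) (R : ℕ → Matrix (Fin m) (Fin m) ℝ)
    (X P : ℕ → Matrix (Fin n) (Fin n) ℝ)
    (hQ : ∀ s, (Q s).PosDef) (hR : ∀ s, (R s).PosDef)
    (hXpos : ∀ s, (X s).PosDef) (hPpos : ∀ s, (P s).PosDef)
    (hXdec : ∀ s, (X s - ricc (A s) (B s) (Q s) (R s) (X (s + 1))).PosSemidef)
    (hPrec : ∀ s, P s = ricc (A s) (B s) (Q s) (R s) (P (s + 1)))
    (hPX : ∀ s, (X s - P s).PosSemidef) :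
    ∀ s,
      (riccIter A B Q R s (T - 1) (X (s + (T - 1)))
        - ricc (A s) (B s) (Q s) (R s)
            (riccIter A B Q R (s + 1) (T - 1) (X (s + 1 + (T - 1))))).PosSemidef ∧
      (riccIter A B Q R s (T - 1) (X (s + (T - 1))) - P s).PosSemidef := by
  intro s
  generalize T - 1 = k
  constructor
  · rw [riccIter_last, show s + 1 + k = s + k + 1 by omega]
    exact riccIter_mono hQ hR
      (ricc_psd (hQ _).posSemidef (hR _) (hXpos _).posSemidef) (hXpos _).posSemidef
      (hXdec (s + k)) k s
  · have h := riccIter_mono (A := A) (B := B) hQ hR (hPpos (s + k)).posSemidef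
      (hXpos (s + k)).posSemidef (hPX (s + k)) k s
    rwa [riccIter_fixed hPrec] at h
end
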